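/- Let p be a real polynomial of degree n ≥ 2 with only real zeroes and d ≥ 2 distinct zeroes, and κ ≤ 0. Then all zeroes of F_κ[p] = p·p'' − κ(p')² are real; moreover for κ < 0 all non-trivial zeroes (those not shared with p) are simple. -/

import Mathlib

open Polynomial

lemma laguerre_aux (c : ℝ) (x : ℝ) (s : Multiset ℝ) :
    ∀ q : ℝ[X], q = C c * (s.map (fun a => X - C a)).prod → q.eval x ≠ 0 →
      0 ≤ (q.derivative.eval x) ^ 2 - q.eval x * q.derivative.derivative.eval x ∧
      (s ≠ 0 →
        0 < (q.derivative.eval x) ^ 2 - q.eval x * q.derivative.derivative.eval x) := by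
  induction s using Multiset.induction_on with
  | empty =>
    intro q hq _
    subst hq
    simp
  | cons a s ih =>
    intro q hq hx
    obtain ⟨r, hr⟩ : ∃ r : ℝ[X], r = C c * (s.map (fun a => X - C a)).prod := ⟨_, rfl⟩
    have hqr : q = (X - C a) * r := by
      rw [hq, hr, Multiset.map_cons, Multiset.prod_cons]; ring
    have hrx : r.eval x ≠ 0 := by
      intro h
      apply hx
      rw [hqr, eval_mul, h, mul_zero]
    have h1 := (ih r hr hrx).1
    have key : (q.derivative.eval x) ^ 2 - q.eval x * q.derivative.derivative.eval x
        = (r.eval x) ^ 2 + (x - a) ^ 2 *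
          ((r.derivative.eval x) ^ 2 - r.eval x * r.derivative.derivative.eval x) := by
      rw [hqr]
      simp
      ring
    have hpos : 0 < (q.derivative.eval x) ^ 2 - q.eval x * q.derivative.derivative.eval x := by
      rw [key]
      have := mul_nonneg (sq_nonneg (x - a)) h1
      positivity
    exact ⟨hpos.le, fun _ => hpos⟩

lemma laguerre_pos (q : ℝ[X]) (hq : q.Splits) (hd : 1 ≤ q.natDegree) (x : ℝ)
    (hx : q.eval x ≠ 0) :
    0 < (q.derivative.eval x) ^ 2 - q.eval x * q.derivative.derivative.eval x := by
  refine (laguerre_aux q.leadingCoeff x q.roots q hq.eq_prod_roots hx).2 ?_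
  intro h
  rw [hq.natDegree_eq_card_roots, h] at hd
  simp at hd

lemma im_aux (c : ℝ) (hc : c ≠ 0) (z : ℂ) (hz : z.im ≠ 0) (s : Multiset ℝ) :
    ∀ q : ℝ[X], q = C c * (s.map (fun a => X - C a)).prod →
      aeval z q ≠ 0 ∧
      (aeval z q.derivative * (starRingEnd ℂ) (aeval z q)).im * z.im ≤ 0 ∧
      (s ≠ 0 → (aeval z q.derivative * (starRingEnd ℂ) (aeval z q)).im * z.im < 0) := by
  induction s using Multiset.induction_on with
  | empty =>
    intro q hq
    subst hq
    simp [hc]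
  | cons a s ih =>
    intro q hq
    obtain ⟨r, hr⟩ : ∃ r : ℝ[X], r = C c * (s.map (fun a => X - C a)).prod := ⟨_, rfl⟩
    have hqr : q = (X - C a) * r := by
      rw [hq, hr, Multiset.map_cons, Multiset.prod_cons]; ring
    obtain ⟨h0, h1, -⟩ := ih r hr
    have hza : z - (a : ℂ) ≠ 0 := by
      intro h
      apply hz
      have := congrArg Complex.im h
      simpa using this
    have e1 : aeval z q = (z - a) * aeval z r := by
      rw [hqr]; simp
    have e2 : aeval z q.derivative = aeval z r + (z - a) * aeval z r.derivative := by
      rw [hqr]; simp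
    have key : (aeval z q.derivative * (starRingEnd ℂ) (aeval z q)).im
        = - (Complex.normSq (aeval z r)) * z.im + Complex.normSq (z - a) *
          (aeval z r.derivative * (starRingEnd ℂ) (aeval z r)).im := by
      rw [e1, e2]
      simp [Complex.normSq_apply]
      ring
    have hneg : (aeval z q.derivative * (starRingEnd ℂ) (aeval z q)).im * z.im < 0 := by
      rw [key]
      have p1 : 0 < Complex.normSq (aeval z r) * z.im ^ 2 :=
        mul_pos (Complex.normSq_pos.2 h0) (by positivity)
      have p2 := mul_nonneg (Complex.normSq_nonneg (z - a)) (neg_nonneg.2 h1)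
      nlinarith
    exact ⟨by rw [e1]; exact mul_ne_zero hza h0, hneg.le, fun _ => hneg⟩

lemma im_neg (q : ℝ[X]) (hq : q.Splits) (hd : 1 ≤ q.natDegree) (z : ℂ) (hz : z.im ≠ 0) :
    aeval z q ≠ 0 ∧
      (aeval z q.derivative * (starRingEnd ℂ) (aeval z q)).im * z.im < 0 := by
  have hc : q.leadingCoeff ≠ 0 := by
    intro h
    rw [leadingCoeff_eq_zero.1 h] at hd
    simp at hd
  have h := im_aux q.leadingCoeff hc z hz q.roots q hq.eq_prod_roots
  refine ⟨h.1, h.2.2 ?_⟩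
  intro h
  rw [hq.natDegree_eq_card_roots, h] at hd
  simp at hd

/-- Let `p` be a real polynomial of degree `n ≥ 2` with only real zeroes and `d ≥ 2`
distinct zeroes, and `κ ≤ 0`. Then all zeroes of `F_κ[p] = p·p'' − κ(p')²` are
real; moreover for `κ < 0` every non-trivial zero (i.e. not a zero of `p`) is
simple. -/
theorem F_kappa_real_rooted_of_kappa_nonpos (p : ℝ[X]) (n : ℕ) (hn : p.natDegree = n)
    (hn2 : 2 ≤ n)
    (hreal : ∀ z : ℂ, (p.map (algebraMap ℝ ℂ)).IsRoot z → z.im = 0)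
    (hd2 : 2 ≤ p.roots.toFinset.card)
    (κ : ℝ) (hκ : κ ≤ 0) :
    (∀ z : ℂ, ((p * derivative (derivative p) - C κ * (derivative p) ^ 2).map
        (algebraMap ℝ ℂ)).IsRoot z → z.im = 0) ∧
    (κ < 0 → ∀ x : ℝ,
        (p * derivative (derivative p) - C κ * (derivative p) ^ 2).eval x = 0 →
        p.eval x ≠ 0 →
        (p * derivative (derivative p) - C κ * (derivative p) ^ 2).rootMultiplicity x
          = 1) := by
  have hsp : p.Splits := by
    refine Splits.of_splits_map (algebraMap ℝ ℂ) (IsAlgClosed.splits _) ?_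
    intro a ha
    have h := hreal a (isRoot_of_mem_roots ha)
    exact ⟨a.re, by apply Complex.ext <;> simp [h]⟩
  have hcard := hsp.natDegree_eq_card_roots
  have hle := card_roots_le_derivative p
  have hdl := natDegree_derivative_le p
  have hcr := card_roots' (derivative p)
  have hsp' : (derivative p).Splits := by
    rw [splits_iff_card_roots]
    omega
  have hd1 : 1 ≤ p.natDegree := by omega
  have hd1' : 1 ≤ (derivative p).natDegree := by omega
  constructor
  · intro z hz
    by_contra him
    obtain ⟨hp0, hp1⟩ := im_neg p hsp hd1 z him
    obtain ⟨-, hp2⟩ := im_neg _ hsp' hd1' z him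
    have hF : aeval z p * aeval z (derivative (derivative p))
        = (κ : ℂ) * (aeval z (derivative p)) ^ 2 := by
      rw [IsRoot.def, eval_map_algebraMap] at hz
      simp at hz
      exact sub_eq_zero.1 hz
    generalize aeval z p = u at *
    generalize aeval z (derivative p) = v at *
    generalize aeval z (derivative (derivative p)) = w at *
    have h3 : (Complex.normSq u : ℂ) * (w * (starRingEnd ℂ) v)
        = ((κ * Complex.normSq v : ℝ) : ℂ) * (v * (starRingEnd ℂ) u) := by
      push_cast
      rw [← Complex.mul_conj, ← Complex.mul_conj]
      linear_combination (starRingEnd ℂ) u * (starRingEnd ℂ) v * hF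
    have h4 := congrArg Complex.im h3
    rw [Complex.im_ofReal_mul, Complex.im_ofReal_mul] at h4
    have p1 := mul_pos (Complex.normSq_pos.2 hp0) (neg_pos.2 hp2)
    have p2 := mul_nonneg (mul_nonneg (neg_nonneg.2 hκ) (Complex.normSq_nonneg v))
      (neg_nonneg.2 hp1.le)
    have h5 := congrArg (· * z.im) h4
    nlinarith
  · intro hκ' x hx hpx
    have hA := laguerre_pos p hsp hd1 x hpx
    have hx' := hx
    simp only [eval_sub, eval_mul, eval_C, eval_pow] at hx'
    have hv : (derivative p).eval x ≠ 0 := by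
      intro h
      rw [h] at hA hx'
      nlinarith
    have hB := laguerre_pos _ hsp' hd1' x hv
    have hder : (derivative (p * derivative (derivative p)
        - C κ * (derivative p) ^ 2)).eval x ≠ 0 := by
      intro h
      simp [derivative_pow] at h
      generalize eval x p = u at *
      generalize eval x (derivative p) = v at *
      generalize eval x (derivative (derivative p)) = w at *
      generalize eval x (derivative (derivative (derivative p))) = t at *
      have h6 : u ^ 2 * (w ^ 2 - v * t) = (κ - κ ^ 2) * v ^ 4 := by
        linear_combination (u * w + κ * v ^ 2 + (1 - 2 * κ) * v ^ 2) * hx' - u * v * h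
      have p1 : 0 < u ^ 2 * (w ^ 2 - v * t) := mul_pos (by positivity) hB
      have p2 : 0 < v ^ 4 := by positivity
      nlinarith [mul_pos (neg_pos.2 hκ') p2, mul_nonneg (sq_nonneg κ) p2.le]
    have hF0 : p * derivative (derivative p) - C κ * (derivative p) ^ 2 ≠ 0 := by
      intro h
      rw [h] at hder
      simp at hder
    have h1 := (rootMultiplicity_pos hF0).2 hx
    have h2 := (one_lt_rootMultiplicity_iff_isRoot hF0).not.2 (fun h => hder h.2)
    omega
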